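/- Let Ψ be obtained from Φ by reduction, and assume Φ' : [0,∞) → [0,∞) is a bijection. Suppose ρ₀ ∈ R_M minimizes the reduced functional H_r, with potential U₀(x) = -∫ ρ₀(y)/|x-y| dy and Lagrange multiplier E₀. Define f₀(x,v) := (Φ')⁻¹(E₀ - E(x,v)) for E(x,v) < E₀ and f₀(x,v) := 0 for E(x,v) ≥ E₀, where E(x,v) = (1/2)|v|² + U₀(x). Then f₀ ∈ F_M and f₀ minimizes the energy-Casimir functional H_C on F_M. -/

import Mathlib

open MeasureTheory Filter Topology Set ENNReal

noncomputable section

/-- Physical space `ℝ³`. -/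
abbrev R3 : Type := EuclideanSpace ℝ (Fin 3)

/-- Spatial density `ρ_f(x) = ∫ f(x,v) dv` induced by a phase-space density. -/
def spatialDensity (f : R3 × R3 → ℝ) (x : R3) : ℝ := ∫ v, f (x, v)

/-- Kinetic energy `E_kin(f) = (1/2)∫∫ |v|² f dv dx`. -/
def Ekin (f : R3 × R3 → ℝ) : ℝ := (1/2) * ∫ p : R3 × R3, ‖p.2‖ ^ 2 * f p

/-- `D(σ) = ∫∫ σ(x)σ(y)/|x-y| dx dy`. -/
def Dpair (σ : R3 → ℝ) : ℝ := ∫ x, ∫ y, σ x * σ y / ‖x - y‖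

/-- Potential energy `E_pot(ρ) = -(1/2)∫∫ ρ(x)ρ(y)/|x-y| dx dy`. -/
def Epot (ρ : R3 → ℝ) : ℝ := -(1/2) * Dpair ρ

/-- Casimir functional `C(f) = ∫∫ Φ(f) dv dx`. -/
def Casimir (Φ : ℝ → ℝ) (f : R3 × R3 → ℝ) : ℝ := ∫ p, Φ (f p)

/-- Energy-Casimir functional `H_C = E_kin + E_pot + C`. -/
def HC (Φ : ℝ → ℝ) (f : R3 × R3 → ℝ) : ℝ :=
  Ekin f + Epot (spatialDensity f) + Casimir Φ f

/-- Membership in the constraint set `F_M`. -/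
structure MemFM (Φ : ℝ → ℝ) (M : ℝ) (f : R3 × R3 → ℝ) : Prop where
  nonneg : ∀ p, 0 ≤ f p
  integrable : Integrable f
  mass : (∫ p, f p) = M
  kin_int : Integrable (fun p : R3 × R3 => ‖p.2‖ ^ 2 * f p)
  cas_int : Integrable (fun p => Φ (f p))

/-- The constraint set `F_M`. -/
def FMset (Φ : ℝ → ℝ) (M : ℝ) : Set ((R3 × R3) → ℝ) := {f | MemFM Φ M f}

/-- Hypotheses (Φ1)-(Φ3) on the Casimir function `Φ`, with derivative `Φ'`
and growth exponents `k`, `k'`. -/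
structure IsPhi (Φ Φ' : ℝ → ℝ) (k k' : ℝ) : Prop where
  zero : Φ 0 = 0
  deriv_zero : Φ' 0 = 0
  hasDeriv : ∀ s ∈ Ici (0:ℝ), HasDerivAt Φ (Φ' s) s
  derivCont : ContinuousOn Φ' (Ici 0)
  nonneg : ∀ s ∈ Ici (0:ℝ), 0 ≤ Φ s
  sconvex : StrictConvexOn ℝ (Ici 0) Φ
  k_pos : 0 < k
  k_lt : k < 3/2
  k'_pos : 0 < k'
  k'_lt : k' < 3/2
  growth_large : ∃ C > 0, ∃ F₁ > 0, ∀ s, F₁ ≤ s → C * s ^ (1 + 1/k) ≤ Φ s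
  growth_small : ∃ C > 0, ∃ F₂ > 0, ∀ s, 0 ≤ s → s ≤ F₂ → Φ s ≤ C * s ^ (1 + 1/k')

/-- Potential `U_ρ(x) = -∫ ρ(y)/|x-y| dy` induced by a spatial density. -/
def U0rho (ρ : R3 → ℝ) (x : R3) : ℝ := -∫ y, ρ y / ‖x - y‖

/-- Particle energy `E(x,v) = (1/2)|v|² + U₀(x)` for the state `f₀`. -/
def Epart (f₀ : R3 × R3 → ℝ) (p : R3 × R3) : ℝ :=
  (1/2) * ‖p.2‖ ^ 2 + U0rho (spatialDensity f₀) p.1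

/-- Reduced density function `Ψ(s)`, obtained from `Φ` by minimizing the sum of kinetic
energy density and Casimir density over all velocity profiles of total mass `s`. -/
def PsiOf (Φ : ℝ → ℝ) (s : ℝ) : ℝ :=
  sInf { r : ℝ | ∃ g : R3 → ℝ, (∀ v, 0 ≤ g v) ∧ Integrable g ∧ (∫ v, g v) = s ∧
    Integrable (fun v => (1/2) * ‖v‖ ^ 2 * g v + Φ (g v)) ∧
    r = ∫ v, ((1/2) * ‖v‖ ^ 2 * g v + Φ (g v)) }

/-- Reduced functional `H_r(ρ) = ∫ Ψ(ρ) dx + E_pot(ρ)`. -/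
def Hr (Ψ : ℝ → ℝ) (ρ : R3 → ℝ) : ℝ := (∫ x, Ψ (ρ x)) + Epot ρ

/-- Membership in the reduced constraint set `R_M`. -/
structure MemRM (Ψ : ℝ → ℝ) (M : ℝ) (ρ : R3 → ℝ) : Prop where
  nonneg : ∀ x, 0 ≤ ρ x
  integrable : Integrable ρ
  mass : (∫ x, ρ x) = M
  psi_int : Integrable (fun x => Ψ (ρ x))

/-- The reduced constraint set `R_M`. -/
def RMset (Ψ : ℝ → ℝ) (M : ℝ) : Set (R3 → ℝ) := {ρ | MemRM Ψ M ρ}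

/-- Hypotheses (Ψ1)-(Ψ3) on `Ψ`, with derivative `Ψ'` and growth exponents `n`, `n'`. -/
structure IsPsi (Ψ Ψ' : ℝ → ℝ) (n n' : ℝ) : Prop where
  zero : Ψ 0 = 0
  deriv_zero : Ψ' 0 = 0
  hasDeriv : ∀ s ∈ Ici (0:ℝ), HasDerivAt Ψ (Ψ' s) s
  derivCont : ContinuousOn Ψ' (Ici 0)
  nonneg : ∀ s ∈ Ici (0:ℝ), 0 ≤ Ψ s
  sconvex : StrictConvexOn ℝ (Ici 0) Ψ
  n_pos : 0 < n
  n_lt : n < 3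
  n'_pos : 0 < n'
  n'_lt : n' < 3
  growth_large : ∃ C > 0, ∃ s₁ > 0, ∀ s, s₁ ≤ s → C * s ^ (1 + 1/n) ≤ Ψ s
  growth_small : ∃ C > 0, ∃ s₂ > 0, ∀ s, 0 ≤ s → s ≤ s₂ → Ψ s ≤ C * s ^ (1 + 1/n')

/-- Relative "distance" `d(f,f₀) = ∫∫ [Φ(f) - Φ(f₀) + E (f - f₀)] dv dx`. -/
def dVP (Φ : ℝ → ℝ) (f₀ f : R3 × R3 → ℝ) : ℝ :=
  ∫ p, (Φ (f p) - Φ (f₀ p) + Epart f₀ p * (f p - f₀ p))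

/-- The state `f₀ = (Φ')⁻¹(E₀ - E)` for `E < E₀`, `f₀ = 0` for `E ≥ E₀`,
built from a minimizer `ρ₀` of the reduced functional. -/
def f0Of (Φinv : ℝ → ℝ) (ρ₀ : R3 → ℝ) (E₀ : ℝ) (p : R3 × R3) : ℝ :=
  if (1/2) * ‖p.2‖ ^ 2 + U0rho ρ₀ p.1 < E₀
  then Φinv (E₀ - ((1/2) * ‖p.2‖ ^ 2 + U0rho ρ₀ p.1)) else 0

/-- A monotone self-surjection of `[0,∞)` is continuous. -/
lemma cont_of_mono_surj (f : ℝ → ℝ) (mono : ∀ a b, 0 ≤ a → a ≤ b → f a ≤ f b)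
    (nn : ∀ a, 0 ≤ a → 0 ≤ f a) (surj : ∀ y, 0 ≤ y → ∃ a, 0 ≤ a ∧ f a = y) :
    Continuous (fun y => f (max y 0)) := by
  have f0 : f 0 = 0 := by
    obtain ⟨a, ha, h⟩ := surj 0 le_rfl
    have := mono 0 a le_rfl ha
    have := nn 0 le_rfl
    linarith
  have hm : Monotone (fun y => f (max y 0) + min y 0) := by
    intro a b hab
    have h1 := mono (max a 0) (max b 0) (le_max_right _ _) (max_le_max_right 0 hab)
    have h2 : min a 0 ≤ min b 0 := min_le_min_right 0 hab
    simp only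
    linarith
  have hs : Function.Surjective (fun y => f (max y 0) + min y 0) := by
    intro y
    rcases le_or_gt 0 y with hy | hy
    · obtain ⟨a, ha, h⟩ := surj y hy
      exact ⟨a, by simp [max_eq_left ha, min_eq_right ha, h]⟩
    · exact ⟨y, by simp [max_eq_right hy.le, min_eq_left hy.le, f0]⟩
  have hc := hm.continuous_of_surjective hs
  have : (fun y => f (max y 0)) = fun y => (f (max y 0) + min y 0) - min y 0 := by
    funext y; ring
  rw [this]
  exact hc.sub (continuous_id.min continuous_const)

/-- All properties of the pair `(Φ, G)`, `G = (Φ')⁻¹ ∘ max(·,0)`, needed later on. -/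
structure GoodG (Φ G : ℝ → ℝ) : Prop where
  cont : Continuous G
  mono : Monotone G
  nonneg : ∀ y, 0 ≤ G y
  zero : ∀ y, y ≤ 0 → G y = 0
  strict : ∀ a b, a < b → 0 < b → G a < G b
  unbdd : ∀ s, ∃ y, 0 ≤ y ∧ s ≤ G y
  opt : ∀ s e, 0 ≤ s → Φ (G e) - e * G e ≤ Φ s - e * s
  phi_cont : Continuous (fun s => Φ (max s 0))
  phi_nonneg : ∀ s, 0 ≤ s → 0 ≤ Φ s
  phi_zero : Φ 0 = 0
  growth : ∃ C : ℝ, 0 < C ∧ ∀ s, 0 ≤ s → s ^ ((5:ℝ)/3) ≤ C * (Φ s + s)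

lemma phi_tangent {Φ Φ' : ℝ → ℝ} {k k' : ℝ} (hΦ : IsPhi Φ Φ' k k') {a b : ℝ} (ha : 0 ≤ a)
    (hb : 0 ≤ b) : Φ a + Φ' a * (b - a) ≤ Φ b := by
  have hc := hΦ.sconvex.convexOn
  rcases lt_trichotomy a b with h | h | h
  · have := hc.le_slope_of_hasDerivAt (x := a) (y := b) ha hb h (hΦ.hasDeriv a ha)
    rw [slope_def_field, le_div_iff₀ (by linarith)] at this
    linarith
  · subst h; simp
  · have := hc.slope_le_of_hasDerivAt (x := b) (y := a) hb ha h (hΦ.hasDeriv a ha)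
    rw [slope_def_field, div_le_iff₀ (by linarith)] at this
    linarith

lemma phi_growth {Φ Φ' : ℝ → ℝ} {k k' : ℝ} (hΦ : IsPhi Φ Φ' k k') :
    ∃ C : ℝ, 0 < C ∧ ∀ s, 0 ≤ s → s ^ ((5:ℝ)/3) ≤ C * (Φ s + s) := by
  obtain ⟨c, hc, F, hF, h⟩ := hΦ.growth_large
  set S := max F 1 with hS
  have hS1 : 1 ≤ S := le_max_right _ _
  refine ⟨max (1/c) (S ^ ((2:ℝ)/3)), lt_max_of_lt_left (by positivity), fun s hs => ?_⟩
  have hp := hΦ.nonneg s hs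
  rcases le_total s S with h1 | h1
  · have e : s ^ ((5:ℝ)/3) = s * s ^ ((2:ℝ)/3) := by
      rw [show (5:ℝ)/3 = 1 + 2/3 by norm_num, Real.rpow_add' hs (by norm_num), Real.rpow_one]
    calc s ^ ((5:ℝ)/3) = s * s ^ ((2:ℝ)/3) := e
      _ ≤ s * S ^ ((2:ℝ)/3) := by gcongr
      _ = S ^ ((2:ℝ)/3) * s := mul_comm _ _
      _ ≤ max (1/c) (S ^ ((2:ℝ)/3)) * (Φ s + s) := by
        gcongr
        · exact le_max_right _ _
        · linarith
  · have hs1 : 1 ≤ s := hS1.trans h1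
    have hexp : (5:ℝ)/3 ≤ 1 + 1/k := by
      have : (2:ℝ)/3 ≤ 1/k := by
        rw [le_div_iff₀ hΦ.k_pos]; linarith [hΦ.k_lt]
      linarith
    calc s ^ ((5:ℝ)/3) ≤ s ^ (1 + 1/k) := Real.rpow_le_rpow_of_exponent_le hs1 hexp
      _ = (1/c) * (c * s ^ (1 + 1/k)) := by field_simp
      _ ≤ (1/c) * Φ s := by
        gcongr
        exact h s ((le_max_left _ _).trans h1)
      _ ≤ max (1/c) (S ^ ((2:ℝ)/3)) * (Φ s + s) := by
        gcongr
        · exact le_max_left _ _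
        · linarith

lemma goodG_of {Φ Φ' : ℝ → ℝ} {k k' : ℝ} (hΦ : IsPhi Φ Φ' k k') {Φinv : ℝ → ℝ}
    (hmap : ∀ s, 0 ≤ s → 0 ≤ Φ' s)
    (hleft : ∀ s, 0 ≤ s → Φinv (Φ' s) = s)
    (hright : ∀ y, 0 ≤ y → 0 ≤ Φinv y ∧ Φ' (Φinv y) = y) :
    GoodG Φ (fun y => Φinv (max y 0)) := by
  have hz : Φinv 0 = 0 := by
    have := hleft 0 le_rfl
    rwa [hΦ.deriv_zero] at this
  have dmono : ∀ a b, 0 ≤ a → 0 ≤ b → a < b → Φ' a ≤ Φ' b := by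
    intro a b ha hb hab
    have h1 := phi_tangent hΦ ha hb
    have h2 := phi_tangent hΦ hb ha
    nlinarith
  have istrict : ∀ a b, 0 ≤ a → a < b → Φinv a < Φinv b := by
    intro a b ha hab
    have hb : 0 ≤ b := ha.trans hab.le
    by_contra hcon
    rcases (not_lt.mp hcon).lt_or_eq with h | h
    · have := dmono _ _ (hright b hb).1 (hright a ha).1 h
      rw [(hright b hb).2, (hright a ha).2] at this
      linarith
    · have := congrArg Φ' h
      rw [(hright b hb).2, (hright a ha).2] at this
      linarith
  have imono : ∀ a b, 0 ≤ a → a ≤ b → Φinv a ≤ Φinv b := by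
    intro a b ha hab
    rcases hab.lt_or_eq with h | h
    · exact (istrict a b ha h).le
    · rw [h]
  refine ⟨?_, ?_, ?_, ?_, ?_, ?_, ?_, ?_, ?_, hΦ.zero, phi_growth hΦ⟩
  · exact cont_of_mono_surj Φinv imono (fun a ha => (hright a ha).1)
      (fun y hy => ⟨Φ' y, hmap y hy, hleft y hy⟩)
  · intro a b hab
    exact imono _ _ (le_max_right _ _) (max_le_max_right 0 hab)
  · intro y
    exact (hright _ (le_max_right _ _)).1
  · intro y hy
    simp [max_eq_right hy, hz]
  · intro a b hab hb
    refine istrict _ _ (le_max_right _ _) ?_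
    rw [max_eq_left hb.le]
    exact max_lt hab hb
  · intro s
    refine ⟨Φ' (max s 0), hmap _ (le_max_right _ _), ?_⟩
    simp only [max_eq_left (hmap _ (le_max_right s 0)), hleft _ (le_max_right s 0)]
    exact le_max_left _ _
  · intro s e hs
    rcases le_total 0 e with he | he
    · rw [max_eq_left he]
      have := phi_tangent hΦ (hright e he).1 hs
      rw [(hright e he).2] at this
      linarith
    · rw [max_eq_right he, hz, hΦ.zero]
      have := hΦ.nonneg s hs
      nlinarith
  · have : ContinuousOn Φ (Ici 0) := fun s hs => (hΦ.hasDeriv s hs).continuousAt.continuousWithinAt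
    exact this.comp_continuous (continuous_id.max continuous_const) (fun s => mem_Ici.mpr (le_max_right _ _))
  · exact fun s hs => hΦ.nonneg s hs

/-- Mass of the optimal velocity profile with multiplier `l`. -/
def mG (G : ℝ → ℝ) (l : ℝ) : ℝ := ∫ v : R3, G (l - (1/2) * ‖v‖ ^ 2)

/-- Multiplier belonging to the mass `s`. -/
def LG (G : ℝ → ℝ) (s : ℝ) : ℝ := Classical.epsilon (fun l => 0 ≤ l ∧ mG G l = s)

lemma prof_cont {Φ G : ℝ → ℝ} (hG : GoodG Φ G) (l : ℝ) :
    Continuous (fun v : R3 => G (l - (1/2) * ‖v‖ ^ 2)) :=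
  hG.cont.comp (by fun_prop)

lemma cs_of_prof {l : ℝ} {F : R3 → ℝ} (h : ∀ v, l - (1/2) * ‖v‖ ^ 2 ≤ 0 → F v = 0) :
    HasCompactSupport F := by
  refine HasCompactSupport.intro (isCompact_closedBall (0 : R3) (|l| + 1)) ?_
  intro v hv
  apply h
  have : |l| + 1 < ‖v‖ := by simpa using hv
  have h0 := abs_nonneg l
  have h1 := le_abs_self l
  nlinarith

lemma prof_cs {Φ G : ℝ → ℝ} (hG : GoodG Φ G) (l : ℝ) :
    HasCompactSupport (fun v : R3 => G (l - (1/2) * ‖v‖ ^ 2)) :=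
  cs_of_prof (fun _ hv => hG.zero _ hv)

lemma prof_int {Φ G : ℝ → ℝ} (hG : GoodG Φ G) (l : ℝ) :
    Integrable (fun v : R3 => G (l - (1/2) * ‖v‖ ^ 2)) :=
  (prof_cont hG l).integrable_of_hasCompactSupport (prof_cs hG l)

lemma phi_prof_cont {Φ G : ℝ → ℝ} (hG : GoodG Φ G) :
    Continuous (fun y => Φ (G y)) := by
  have := hG.phi_cont.comp hG.cont
  refine this.congr (fun y => ?_)
  simp [max_eq_left (hG.nonneg y)]

lemma prof_h_int {Φ G : ℝ → ℝ} (hG : GoodG Φ G) (l : ℝ) :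
    Integrable (fun v : R3 => (1/2) * ‖v‖ ^ 2 * G (l - (1/2) * ‖v‖ ^ 2)
      + Φ (G (l - (1/2) * ‖v‖ ^ 2))) := by
  apply Continuous.integrable_of_hasCompactSupport
  · have h1 := prof_cont hG l
    have h2 : Continuous (fun v : R3 => Φ (G (l - (1/2) * ‖v‖ ^ 2))) :=
      (phi_prof_cont hG).comp (by fun_prop)
    exact (Continuous.mul (by fun_prop) h1).add h2
  · refine cs_of_prof (l := l) (fun v hv => ?_)
    rw [hG.zero _ hv, hG.phi_zero]; simp

lemma mG_strict {Φ G : ℝ → ℝ} (hG : GoodG Φ G) {a b : ℝ} (hab : a < b) (hb : 0 < b) :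
    mG G a < mG G b := by
  have h : 0 < ∫ v : R3, (G (b - (1/2) * ‖v‖ ^ 2) - G (a - (1/2) * ‖v‖ ^ 2)) := by
    apply Continuous.integral_pos_of_hasCompactSupport_nonneg_nonzero (x := 0)
    · exact (prof_cont hG b).sub (prof_cont hG a)
    · refine cs_of_prof (l := b) (fun v hv => ?_)
      rw [hG.zero _ hv, hG.zero _ (by linarith)]; simp
    · intro v
      have := hG.mono (show a - (1/2) * ‖v‖ ^ 2 ≤ b - (1/2) * ‖v‖ ^ 2 by linarith)
      simp only [Pi.zero_apply]
      linarith
    · have := hG.strict a b hab hb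
      simp
      linarith
  rw [integral_sub (prof_int hG b) (prof_int hG a)] at h
  unfold mG
  linarith

lemma mG_zero {Φ G : ℝ → ℝ} (hG : GoodG Φ G) {l : ℝ} (hl : l ≤ 0) : mG G l = 0 := by
  unfold mG
  have : ∀ v : R3, G (l - (1/2) * ‖v‖ ^ 2) = 0 := fun v =>
    hG.zero _ (by have := sq_nonneg ‖v‖; linarith)
  simp only [this, integral_zero]

lemma mG_nonneg {Φ G : ℝ → ℝ} (hG : GoodG Φ G) (l : ℝ) : 0 ≤ mG G l :=
  integral_nonneg (fun _ => hG.nonneg _)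

lemma mG_cont {Φ G : ℝ → ℝ} (hG : GoodG Φ G) : Continuous (mG G) := by
  rw [continuous_iff_continuousAt]
  intro l
  apply continuousAt_of_dominated (bound := fun v : R3 => G ((l + 1) - (1/2) * ‖v‖ ^ 2))
  · exact Eventually.of_forall (fun x => (prof_cont hG x).aestronglyMeasurable)
  · filter_upwards [gt_mem_nhds (show l < l + 1 by linarith)] with x hx
    refine Eventually.of_forall (fun v => ?_)
    rw [Real.norm_of_nonneg (hG.nonneg _)]
    exact hG.mono (by linarith)
  · exact prof_int hG _
  · refine Eventually.of_forall (fun v => ?_)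
    exact (hG.cont.comp (by fun_prop)).continuousAt

lemma mG_unbdd {Φ G : ℝ → ℝ} (hG : GoodG Φ G) (s : ℝ) : ∃ l, 0 ≤ l ∧ s ≤ mG G l := by
  set c := volume.real (Metric.closedBall (0 : R3) 1) with hc
  have hcpos : 0 < c := by
    refine ENNReal.toReal_pos (Metric.measure_closedBall_pos volume _ one_pos).ne' ?_
    exact measure_closedBall_lt_top.ne
  obtain ⟨y, hy, hs⟩ := hG.unbdd (s / c)
  refine ⟨y + 1/2, by linarith, ?_⟩
  have h1 : ∫ v in Metric.closedBall (0 : R3) 1, G y ≤ mG G (y + 1/2) := by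
    unfold mG
    calc ∫ v in Metric.closedBall (0 : R3) 1, G y
        ≤ ∫ v in Metric.closedBall (0 : R3) 1, G (y + 1/2 - (1/2) * ‖v‖ ^ 2) := by
          apply setIntegral_mono_on
          · exact integrableOn_const measure_closedBall_lt_top.ne
          · exact (prof_int hG _).integrableOn
          · exact Metric.isClosed_closedBall.measurableSet
          · intro v hv
            have hv' : ‖v‖ ≤ 1 := by simpa using hv
            apply hG.mono
            have := norm_nonneg v
            nlinarith
      _ ≤ _ := setIntegral_le_integral (prof_int hG _)
          (Eventually.of_forall (fun v => hG.nonneg _))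
  rw [setIntegral_const, smul_eq_mul] at h1
  rw [div_le_iff₀ hcpos] at hs
  linarith [mul_comm (G y) c]

lemma LG_spec {Φ G : ℝ → ℝ} (hG : GoodG Φ G) {s : ℝ} (hs : 0 ≤ s) :
    0 ≤ LG G s ∧ mG G (LG G s) = s := by
  have : ∃ l, 0 ≤ l ∧ mG G l = s := by
    obtain ⟨b, hb, hsb⟩ := mG_unbdd hG s
    have := intermediate_value_Icc hb (mG_cont hG).continuousOn
    obtain ⟨l, hl, h⟩ := this ⟨by rw [mG_zero hG le_rfl]; exact hs, hsb⟩
    exact ⟨l, hl.1, h⟩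
  exact Classical.epsilon_spec this

lemma LG_mG {Φ G : ℝ → ℝ} (hG : GoodG Φ G) {l : ℝ} (hl : 0 ≤ l) : LG G (mG G l) = l := by
  obtain ⟨h0, h⟩ := LG_spec hG (mG_nonneg hG l)
  rcases lt_trichotomy (LG G (mG G l)) l with h1 | h1 | h1
  · have := mG_strict hG h1 (h0.trans_lt h1); linarith
  · exact h1
  · have := mG_strict hG h1 (hl.trans_lt h1); linarith

lemma LG_mono {Φ G : ℝ → ℝ} (hG : GoodG Φ G) (a b : ℝ) (ha : 0 ≤ a) (hab : a ≤ b) :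
    LG G a ≤ LG G b := by
  by_contra hcon
  push Not at hcon
  obtain ⟨h0, h⟩ := LG_spec hG ha
  obtain ⟨h0', h'⟩ := LG_spec hG (ha.trans hab)
  have := mG_strict hG hcon (h0'.trans_lt hcon)
  linarith

lemma LG_zero {Φ G : ℝ → ℝ} (hG : GoodG Φ G) : LG G 0 = 0 := by
  have := LG_mG hG le_rfl
  rwa [mG_zero hG le_rfl] at this

lemma LG_cont {Φ G : ℝ → ℝ} (hG : GoodG Φ G) : Continuous (fun s => LG G (max s 0)) :=
  cont_of_mono_surj _ (LG_mono hG) (fun _ ha => (LG_spec hG ha).1)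
    (fun y hy => ⟨mG G y, mG_nonneg hG y, LG_mG hG hy⟩)

lemma psi_le {Φ : ℝ → ℝ} (hp : ∀ s, 0 ≤ s → 0 ≤ Φ s) {g : R3 → ℝ} (h0 : ∀ v, 0 ≤ g v)
    (hi : Integrable g) (hh : Integrable (fun v => (1/2) * ‖v‖ ^ 2 * g v + Φ (g v))) :
    PsiOf Φ (∫ v, g v) ≤ ∫ v, ((1/2) * ‖v‖ ^ 2 * g v + Φ (g v)) := by
  apply csInf_le
  · refine ⟨0, ?_⟩
    rintro r ⟨g, h0, -, -, -, rfl⟩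
    refine integral_nonneg (fun v => ?_)
    have := h0 v
    have := hp _ this
    positivity
  · exact ⟨g, h0, hi, rfl, hh, rfl⟩

lemma le_psi {Φ G : ℝ → ℝ} (hG : GoodG Φ G) {s b : ℝ} (hs : 0 ≤ s)
    (h : ∀ g : R3 → ℝ, (∀ v, 0 ≤ g v) → Integrable g → (∫ v, g v) = s →
      Integrable (fun v => (1/2) * ‖v‖ ^ 2 * g v + Φ (g v)) →
      b ≤ ∫ v, ((1/2) * ‖v‖ ^ 2 * g v + Φ (g v))) : b ≤ PsiOf Φ s := by
  apply le_csInf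
  · exact ⟨_, fun v => G (LG G s - (1/2) * ‖v‖ ^ 2), fun v => hG.nonneg _, prof_int hG _,
      (LG_spec hG hs).2, prof_h_int hG _, rfl⟩
  · rintro r ⟨g, h0, h1, h2, h3, rfl⟩
    exact h g h0 h1 h2 h3

lemma prof_opt {Φ G : ℝ → ℝ} (hG : GoodG Φ G) (l : ℝ) {t : ℝ} (ht : 0 ≤ t) :
    (∫ v : R3, ((1/2) * ‖v‖ ^ 2 * G (l - (1/2) * ‖v‖ ^ 2)
      + Φ (G (l - (1/2) * ‖v‖ ^ 2)))) + l * (t - mG G l) ≤ PsiOf Φ t := by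
  apply le_psi hG ht
  intro g h0 hi hm hh
  have h1 : ∫ v : R3, (((1/2) * ‖v‖ ^ 2 * G (l - (1/2) * ‖v‖ ^ 2)
      + Φ (G (l - (1/2) * ‖v‖ ^ 2))) - l * G (l - (1/2) * ‖v‖ ^ 2)) ≤
      ∫ v : R3, (((1/2) * ‖v‖ ^ 2 * g v + Φ (g v)) - l * g v) := by
    apply integral_mono
    · exact (prof_h_int hG l).sub ((prof_int hG l).const_mul l)
    · exact hh.sub (hi.const_mul l)
    · intro v
      have := hG.opt (g v) (l - (1/2) * ‖v‖ ^ 2) (h0 v)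
      simp only
      nlinarith
  rw [integral_sub (prof_h_int hG l) ((prof_int hG l).const_mul l),
    integral_sub hh (hi.const_mul l), integral_const_mul, integral_const_mul, hm] at h1
  unfold mG
  linarith

lemma prof_attain {Φ G : ℝ → ℝ} (hG : GoodG Φ G) (l : ℝ) :
    PsiOf Φ (mG G l) = ∫ v : R3, ((1/2) * ‖v‖ ^ 2 * G (l - (1/2) * ‖v‖ ^ 2)
      + Φ (G (l - (1/2) * ‖v‖ ^ 2))) := by
  apply le_antisymm
  · exact psi_le hG.phi_nonneg (fun v => hG.nonneg _) (prof_int hG l) (prof_h_int hG l)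
  · have := prof_opt hG l (mG_nonneg hG l)
    simpa using this

lemma psi_tangent {Φ G : ℝ → ℝ} (hG : GoodG Φ G) {s t : ℝ} (hs : 0 ≤ s) (ht : 0 ≤ t) :
    PsiOf Φ s + LG G s * (t - s) ≤ PsiOf Φ t := by
  have h1 := prof_opt hG (LG G s) ht
  have h2 := prof_attain hG (LG G s)
  rw [(LG_spec hG hs).2] at h1 h2
  rw [h2]; exact h1

lemma psi_zero {Φ G : ℝ → ℝ} (hG : GoodG Φ G) : PsiOf Φ 0 = 0 := by
  have h2 := prof_attain hG 0
  rw [mG_zero hG le_rfl] at h2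
  rw [h2]
  have : ∀ v : R3, G (0 - (1/2) * ‖v‖ ^ 2) = 0 := fun v =>
    hG.zero _ (by have := sq_nonneg ‖v‖; linarith)
  simp only [this, hG.phi_zero, mul_zero, add_zero, integral_zero]

lemma psi_mono {Φ G : ℝ → ℝ} (hG : GoodG Φ G) {s t : ℝ} (hs : 0 ≤ s) (hst : s ≤ t) :
    PsiOf Φ s ≤ PsiOf Φ t := by
  have h := psi_tangent hG hs (hs.trans hst)
  have := mul_nonneg (LG_spec hG hs).1 (sub_nonneg.mpr hst)
  linarith

lemma psi_nonneg {Φ G : ℝ → ℝ} (hG : GoodG Φ G) {s : ℝ} (hs : 0 ≤ s) : 0 ≤ PsiOf Φ s := by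
  have := psi_mono hG le_rfl hs
  rwa [psi_zero hG] at this

lemma psi_meas {Φ G : ℝ → ℝ} (hG : GoodG Φ G) : Measurable (fun s => PsiOf Φ (max s 0)) := by
  apply Monotone.measurable
  intro a b hab
  exact psi_mono hG (le_max_right _ _) (max_le_max_right 0 hab)

lemma psi_aesm {Φ G : ℝ → ℝ} (hG : GoodG Φ G) {ρ : R3 → ℝ} (h0 : ∀ x, 0 ≤ ρ x)
    (hm : AEStronglyMeasurable ρ volume) :
    AEStronglyMeasurable (fun x => PsiOf Φ (ρ x)) volume := by
  have := ((psi_meas hG).comp_aemeasurable hm.aemeasurable).aestronglyMeasurable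
  refine this.congr (Eventually.of_forall (fun x => ?_))
  simp [max_eq_left (h0 x)]

lemma psi_deriv {Φ G : ℝ → ℝ} (hG : GoodG Φ G) {s : ℝ} (hs : 0 < s) :
    deriv (PsiOf Φ) s = LG G s := by
  apply HasDerivAt.deriv
  rw [hasDerivAt_iff_isLittleO, Asymptotics.isLittleO_iff]
  intro c hc
  have hcont := (LG_cont hG).continuousAt (x := s)
  have h1 := Metric.continuousAt_iff'.mp hcont c hc
  filter_upwards [h1, lt_mem_nhds hs] with t ht ht0
  rw [Real.dist_eq, max_eq_left hs.le, max_eq_left ht0.le] at ht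
  have a1 := psi_tangent hG hs.le ht0.le
  have a2 := psi_tangent hG ht0.le hs.le
  have hnn : 0 ≤ PsiOf Φ t - PsiOf Φ s - (t - s) * LG G s := by linarith
  rw [smul_eq_mul, Real.norm_of_nonneg hnn, Real.norm_eq_abs]
  calc PsiOf Φ t - PsiOf Φ s - (t - s) * LG G s ≤ (LG G t - LG G s) * (t - s) := by linarith
    _ ≤ |(LG G t - LG G s) * (t - s)| := le_abs_self _
    _ = |LG G t - LG G s| * |t - s| := abs_mul _ _
    _ ≤ c * |t - s| := by gcongr

lemma psi_growth {Φ G : ℝ → ℝ} (hG : GoodG Φ G) :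
    ∃ C : ℝ, 0 < C ∧ ∀ s, 0 ≤ s → s ^ ((4:ℝ)/3) ≤ C * (PsiOf Φ s + s) := by
  obtain ⟨C, hC, hgr⟩ := hG.growth
  set D := max C 2 with hD
  have hDC : C ≤ D := le_max_left _ _
  have hD2 : 2 ≤ D := le_max_right _ _
  set c := volume.real (Metric.ball (0 : R3) 1) with hc
  have hcpos : 0 < c :=
    ENNReal.toReal_pos (Metric.measure_ball_pos volume _ one_pos).ne' measure_ball_lt_top.ne
  -- the basic estimate
  have key : ∀ R : ℝ, 0 < R → ∀ s, 0 ≤ s → R ^ 2 * s - R ^ 8 * c - D * s ≤ D * PsiOf Φ s := by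
    intro R hR s hs
    have hDpos : 0 < D := by linarith
    rw [← div_le_iff₀' hDpos]
    apply le_psi hG hs
    intro g h0 hi hm hh
    rw [div_le_iff₀' hDpos]
    have hball : Integrable ((Metric.ball (0 : R3) R).indicator (fun _ => R ^ 5)) :=
      (integrable_indicator_iff Metric.isOpen_ball.measurableSet).mpr
        (integrableOn_const measure_ball_lt_top.ne)
    have hsum : Integrable (fun v => ((1/2) * ‖v‖ ^ 2 * g v + Φ (g v)) + g v) := hh.add hi
    have hDs : Integrable (fun v => D * (((1/2) * ‖v‖ ^ 2 * g v + Φ (g v)) + g v)) :=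
      hsum.const_mul D
    have hall : Integrable (fun v => (Metric.ball (0 : R3) R).indicator (fun _ => R ^ 5) v
        + D * (((1/2) * ‖v‖ ^ 2 * g v + Φ (g v)) + g v)) := hball.add hDs
    have h1 : ∫ v, R ^ 2 * g v ≤ ∫ v, ((Metric.ball (0 : R3) R).indicator (fun _ => R ^ 5) v
        + D * (((1/2) * ‖v‖ ^ 2 * g v + Φ (g v)) + g v)) := by
      apply integral_mono (hi.const_mul _) hall
      intro v
      simp only
      have hg := h0 v
      have hp := hG.phi_nonneg _ hg
      have hsq := sq_nonneg ‖v‖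
      have hk : 0 ≤ (1/2) * ‖v‖ ^ 2 * g v := by positivity
      have hind : 0 ≤ (Metric.ball (0 : R3) R).indicator (fun _ => R ^ 5) v :=
        indicator_nonneg (fun _ _ => by positivity) v
      by_cases hv : v ∈ Metric.ball (0 : R3) R
      · rw [indicator_of_mem hv]
        rcases le_total (g v) (R ^ 3) with hle | hle
        · have : R ^ 2 * g v ≤ R ^ 5 := by nlinarith [pow_pos hR 2]
          have : 0 ≤ D * (((1/2) * ‖v‖ ^ 2 * g v + Φ (g v)) + g v) := by positivity
          linarith
        · have e : g v ^ ((5:ℝ)/3) = g v * g v ^ ((2:ℝ)/3) := by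
            rw [show (5:ℝ)/3 = 1 + 2/3 by norm_num, Real.rpow_add' hg (by norm_num), Real.rpow_one]
          have e2 : R ^ 2 ≤ g v ^ ((2:ℝ)/3) := by
            calc R ^ 2 = (R ^ 3) ^ ((2:ℝ)/3) := by
                  rw [← Real.rpow_natCast R 3, ← Real.rpow_mul hR.le, ← Real.rpow_natCast R 2]
                  norm_num
              _ ≤ _ := by gcongr
          have e3 : R ^ 2 * g v ≤ C * (Φ (g v) + g v) := by
            calc R ^ 2 * g v ≤ g v ^ ((2:ℝ)/3) * g v := by gcongr
              _ = g v ^ ((5:ℝ)/3) := by rw [e, mul_comm]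
              _ ≤ _ := hgr _ hg
          have e4 : C * (Φ (g v) + g v) ≤ D * (Φ (g v) + g v) := by gcongr
          have e5 : 0 ≤ D * ((1/2) * ‖v‖ ^ 2 * g v) := by positivity
          have e6 : 0 < R ^ 5 := by positivity
          linarith
      · have hv' : R ≤ ‖v‖ := by simpa using hv
        have e1 : R ^ 2 * g v ≤ ‖v‖ ^ 2 * g v := by gcongr
        have e2 : 2 * ((1/2) * ‖v‖ ^ 2 * g v) ≤ D * ((1/2) * ‖v‖ ^ 2 * g v) := by gcongr
        have e5 : 0 ≤ D * (Φ (g v) + g v) := by positivity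
        linarith
    rw [integral_add hball hDs, integral_const_mul, integral_const_mul,
      integral_add hh hi, hm, integral_indicator Metric.isOpen_ball.measurableSet,
      setIntegral_const, smul_eq_mul] at h1
    have hvol : volume.real (Metric.ball (0 : R3) R) = R ^ 3 * c := by
      rw [hc, measureReal_def, measureReal_def, Measure.addHaar_ball volume _ hR.le,
        ENNReal.toReal_mul, ENNReal.toReal_ofReal (by positivity)]
      simp
    rw [hvol] at h1
    nlinarith
  set δ := min 1 (1 / (2 * c)) with hδ
  have hδ0 : 0 < δ := lt_min one_pos (by positivity)
  have hδ1 : δ ≤ 1 := min_le_left _ _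
  have hδc : c * δ ≤ 1/2 := by
    calc c * δ ≤ c * (1 / (2 * c)) := by gcongr; exact min_le_right _ _
      _ = 1/2 := by field_simp
  refine ⟨2 * D / δ, by positivity, fun s hs => ?_⟩
  rcases hs.eq_or_lt with rfl | hs0
  · rw [psi_zero hG]; simp
  set u := s ^ ((1:ℝ)/3) with hu
  have hu0 : 0 < u := Real.rpow_pos_of_pos hs0 _
  have hu3 : u ^ 3 = s := by
    rw [hu, ← Real.rpow_natCast, ← Real.rpow_mul hs]; norm_num
  have hu4 : s ^ ((4:ℝ)/3) = u ^ 4 := by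
    rw [hu, ← Real.rpow_natCast, ← Real.rpow_mul hs]; norm_num
  have h := key (Real.sqrt (δ * u)) (by positivity) s hs
  have hR2 : Real.sqrt (δ * u) ^ 2 = δ * u := Real.sq_sqrt (by positivity)
  have hR8 : Real.sqrt (δ * u) ^ 8 = (δ * u) ^ 4 := by
    rw [show Real.sqrt (δ * u) ^ 8 = (Real.sqrt (δ * u) ^ 2) ^ 4 by ring, hR2]
  rw [hR2, hR8] at h
  rw [hu4, div_mul_eq_mul_div, le_div_iff₀ hδ0]
  rw [← hu3] at h ⊢
  have hd2 : δ ^ 2 ≤ 1 := pow_le_one₀ hδ0.le hδ1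
  have h5 : (δ * u) ^ 4 * c ≤ (1/2) * (δ * u ^ 4) := by
    calc (δ * u) ^ 4 * c = (δ * u ^ 4) * ((c * δ) * δ ^ 2) := by ring
      _ ≤ (δ * u ^ 4) * ((1/2) * 1) := by gcongr
      _ = _ := by ring
  nlinarith

/-- The truncated squared Newton kernel. -/
def kern (z : R3) : ℝ := if ‖z‖ < 1 then (‖z‖ ^ 2)⁻¹ else 0

lemma kern_nonneg (z : R3) : 0 ≤ kern z := by
  unfold kern; split_ifs <;> positivity

lemma kern_int : Integrable kern := by
  have h := integrable_fun_norm_addHaar (volume : Measure R3)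
    (f := fun y : ℝ => if y < 1 then (y ^ 2)⁻¹ else 0)
  refine h.mpr ?_
  simp only [finrank_euclideanSpace, Fintype.card_fin, smul_eq_mul]
  have h1 : IntegrableOn (fun y : ℝ => (Ioo (0:ℝ) 1).indicator (fun _ => (1:ℝ)) y) (Ioi 0) := by
    refine Integrable.integrableOn ?_
    exact (integrable_indicator_iff measurableSet_Ioo).mpr (integrableOn_const (by simp))
  refine h1.congr_fun (fun y hy => ?_) measurableSet_Ioi
  have hy : 0 < y := hy
  by_cases h2 : y < 1
  · simp [h2, hy]; field_simp
  · simp [h2]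

lemma coulomb_int {ρ : R3 → ℝ} (h0 : ∀ x, 0 ≤ ρ x) (hi : Integrable ρ)
    (hp : Integrable (fun x => ρ x ^ ((4:ℝ)/3))) :
    Integrable (fun p : R3 × R3 => ρ p.1 * ρ p.2 / ‖p.1 - p.2‖) (volume.prod volume) := by
  have i1 := hi.mul_prod hi
  have i2 := hp.mul_prod hp
  have i3 := hp.convolution_integrand (ContinuousLinearMap.mul ℝ ℝ) kern_int
  have i4 := i3.swap
  refine ((i1.add (i2.const_mul (1/2))).add ((i3.add i4).const_mul (1/4))).mono' ?_ ?_
  · have : AEMeasurable (fun p : R3 × R3 => ‖p.1 - p.2‖) (volume.prod volume) := by fun_prop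
    exact (i1.aestronglyMeasurable.aemeasurable.div this).aestronglyMeasurable
  · refine Eventually.of_forall (fun p => ?_)
    have a0 := h0 p.1
    have b0 := h0 p.2
    rw [Real.norm_of_nonneg (by positivity)]
    simp only [Pi.add_apply, Function.comp, Prod.fst_swap, Prod.snd_swap,
      ContinuousLinearMap.mul_apply']
    have hk := kern_nonneg (p.1 - p.2)
    have hsym : kern (p.2 - p.1) = kern (p.1 - p.2) := by
      unfold kern; rw [norm_sub_rev]
    rw [hsym]
    set a := ρ p.1
    set b := ρ p.2
    set A := a ^ ((1:ℝ)/3) with hA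
    set B := b ^ ((1:ℝ)/3) with hB
    have hA0 : 0 ≤ A := Real.rpow_nonneg a0 _
    have hB0 : 0 ≤ B := Real.rpow_nonneg b0 _
    have ha3 : a = A ^ 3 := by rw [hA, ← Real.rpow_natCast, ← Real.rpow_mul a0]; norm_num
    have hb3 : b = B ^ 3 := by rw [hB, ← Real.rpow_natCast, ← Real.rpow_mul b0]; norm_num
    have ha4 : a ^ ((4:ℝ)/3) = A ^ 4 := by
      rw [hA, ← Real.rpow_natCast, ← Real.rpow_mul a0]; norm_num
    have hb4 : b ^ ((4:ℝ)/3) = B ^ 4 := by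
      rw [hB, ← Real.rpow_natCast, ← Real.rpow_mul b0]; norm_num
    rw [ha4, hb4, ha3, hb3]
    by_cases hz : ‖p.1 - p.2‖ < 1
    · have hkern : kern (p.1 - p.2) = (‖p.1 - p.2‖⁻¹) ^ 2 := by
        unfold kern; rw [if_pos hz, inv_pow]
      rw [hkern, div_eq_mul_inv]
      have hK : 0 ≤ ‖p.1 - p.2‖⁻¹ := by positivity
      generalize ‖p.1 - p.2‖⁻¹ = K at hK
      have t0 : 0 ≤ A ^ 3 * B ^ 3 := by positivity
      have t1 := sq_nonneg (A ^ 2 * B ^ 2 - A * B * K)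
      have t2 : 0 ≤ K ^ 2 * (A ^ 2 - B ^ 2) ^ 2 := by positivity
      nlinarith
    · push Not at hz
      have : A ^ 3 * B ^ 3 / ‖p.1 - p.2‖ ≤ A ^ 3 * B ^ 3 := div_le_self (by positivity) hz
      have : 0 ≤ A ^ 4 * B ^ 4 := by positivity
      have : 0 ≤ B ^ 4 * kern (p.1 - p.2) := by positivity
      have : 0 ≤ A ^ 4 * kern (p.1 - p.2) := by positivity
      linarith

lemma coulomb_int' {Φ G : ℝ → ℝ} (hG : GoodG Φ G) {ρ : R3 → ℝ} (h0 : ∀ x, 0 ≤ ρ x)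
    (hi : Integrable ρ) (hp : Integrable (fun x => PsiOf Φ (ρ x))) :
    Integrable (fun p : R3 × R3 => ρ p.1 * ρ p.2 / ‖p.1 - p.2‖) (volume.prod volume) := by
  apply coulomb_int h0 hi
  obtain ⟨C, hC, h⟩ := psi_growth hG
  refine ((hp.add hi).const_mul C).mono' ?_ ?_
  · exact (hi.aestronglyMeasurable.aemeasurable.pow_const _).aestronglyMeasurable
  · refine Eventually.of_forall (fun x => ?_)
    rw [Real.norm_of_nonneg (Real.rpow_nonneg (h0 x) _)]
    exact h _ (h0 x)

lemma U0_meas {ρ : R3 → ℝ} (hi : AEStronglyMeasurable ρ volume) : Measurable (U0rho ρ) := by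
  have : U0rho ρ = U0rho (hi.mk ρ) := by
    funext x
    unfold U0rho
    congr 1
    apply integral_congr_ae
    filter_upwards [hi.ae_eq_mk] with y hy
    rw [hy]
  rw [this]
  unfold U0rho
  refine Measurable.neg ?_
  have hm : Measurable (hi.mk ρ) := hi.stronglyMeasurable_mk.measurable
  have : StronglyMeasurable (fun p : R3 × R3 => hi.mk ρ p.2 / ‖p.1 - p.2‖) := by
    apply Measurable.stronglyMeasurable
    fun_prop
  exact (this.integral_prod_right (ν := volume)).measurable

/-- Bilinear Coulomb form. -/
def BC (a b : R3 → ℝ) : ℝ :=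
  ∫ p : R3 × R3, a p.1 * b p.2 / ‖p.1 - p.2‖ ∂((volume : Measure R3).prod volume)

/-- Integrability of the Coulomb integrand. -/
def CI (a b : R3 → ℝ) : Prop :=
  Integrable (fun p : R3 × R3 => a p.1 * b p.2 / ‖p.1 - p.2‖) ((volume : Measure R3).prod volume)

lemma BC_symm (a b : R3 → ℝ) : BC a b = BC b a := by
  unfold BC
  rw [← integral_prod_swap]
  congr 1
  funext p
  simp only [Prod.fst_swap, Prod.snd_swap]
  rw [norm_sub_rev, mul_comm]

lemma CI_of_le {a b τ : R3 → ℝ} (hτ : CI τ τ) (ha : AEStronglyMeasurable a volume)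
    (hb : AEStronglyMeasurable b volume) (a0 : ∀ x, 0 ≤ a x) (b0 : ∀ x, 0 ≤ b x)
    (hat : ∀ x, a x ≤ τ x) (hbt : ∀ x, b x ≤ τ x) : CI a b := by
  unfold CI at *
  refine hτ.mono' ?_ ?_
  · have h1 : AEMeasurable (fun p : R3 × R3 => ‖p.1 - p.2‖) (volume.prod volume) := by fun_prop
    have h2 : AEMeasurable (fun p : R3 × R3 => a p.1) (volume.prod volume) :=
      ha.aemeasurable.comp_fst
    have h3 : AEMeasurable (fun p : R3 × R3 => b p.2) (volume.prod volume) :=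
      hb.aemeasurable.comp_snd
    exact ((h2.mul h3).div h1).aestronglyMeasurable
  · refine Eventually.of_forall (fun p => ?_)
    have := a0 p.1
    have := b0 p.2
    have := hat p.1
    have := hbt p.2
    rw [Real.norm_of_nonneg (by positivity)]
    gcongr
    linarith

lemma Dpair_eq {a : R3 → ℝ} (h : CI a a) : Dpair a = BC a a := by
  unfold Dpair BC
  rw [integral_prod _ h]

lemma inner_U0 (a ρ : R3 → ℝ) (x : R3) :
    ∫ y, a x * ρ y / ‖x - y‖ = a x * (-U0rho ρ x) := by
  unfold U0rho
  rw [neg_neg, ← integral_const_mul]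
  congr 1
  funext y
  ring

lemma BC_U0 {a ρ : R3 → ℝ} (h : CI a ρ) :
    Integrable (fun x => a x * (-U0rho ρ x)) ∧ ∫ x, a x * (-U0rho ρ x) = BC a ρ := by
  refine ⟨?_, ?_⟩
  · have := h.integral_prod_left
    simpa only [inner_U0] using this
  · unfold BC
    rw [integral_prod _ h]
    simp only [inner_U0]

lemma BC_comb {a b : R3 → ℝ} (haa : CI a a) (hab : CI a b) (hba : CI b a) (hbb : CI b b)
    (r s : ℝ) : BC (fun x => r * a x + s * b x) (fun x => r * a x + s * b x) =
      r ^ 2 * BC a a + 2 * r * s * BC b a + s ^ 2 * BC b b := by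
  have e1 : BC (fun x => r * a x + s * b x) (fun x => r * a x + s * b x) =
      r ^ 2 * BC a a + r * s * BC a b + r * s * BC b a + s ^ 2 * BC b b := by
    unfold BC CI at *
    have i1 := haa.const_mul (r ^ 2)
    have i2 := hab.const_mul (r * s)
    have i3 := hba.const_mul (r * s)
    have i4 := hbb.const_mul (s ^ 2)
    rw [← integral_const_mul, ← integral_const_mul, ← integral_const_mul, ← integral_const_mul,
      ← integral_add i1 i2]
    refine Eq.trans ?_ (congrArg (· + _) (integral_add (i1.add i2) i3))
    refine Eq.trans ?_ (integral_add ((i1.add i2).add i3) i4)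
    congr 1
    funext p
    simp only [Pi.add_apply]
    ring
  rw [e1, BC_symm a b]; ring

lemma vacuum {Φ G : ℝ → ℝ} (hG : GoodG Φ G) {M : ℝ} (hM : 0 < M)
    {ρ₀ : R3 → ℝ} (hρ₀ : MemRM (PsiOf Φ) M ρ₀)
    (hminr : ∀ ρ, MemRM (PsiOf Φ) M ρ → Hr (PsiOf Φ) ρ₀ ≤ Hr (PsiOf Φ) ρ)
    {E₀ : ℝ}
    (hEL : ∀ᵐ x ∂(volume : Measure R3), 0 < ρ₀ x → LG G (ρ₀ x) = E₀ - U0rho ρ₀ x) :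
    ∀ᵐ x ∂(volume : Measure R3), ρ₀ x = 0 → E₀ ≤ U0rho ρ₀ x := by
  by_contra hcon
  have r0 := hρ₀.nonneg
  have ri := hρ₀.integrable
  have rm := ri.aestronglyMeasurable
  set U := U0rho ρ₀ with hU
  have Um : Measurable U := U0_meas rm
  have hA : NullMeasurableSet ({x | ρ₀ x = 0} ∩ {x | U x < E₀}) volume :=
    (nullMeasurableSet_eq_fun rm.aemeasurable aemeasurable_const).inter
      (nullMeasurableSet_lt Um.aemeasurable aemeasurable_const)
  have hApos : 0 < volume ({x | ρ₀ x = 0} ∩ {x | U x < E₀}) := by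
    rw [pos_iff_ne_zero]
    intro h
    apply hcon
    rw [ae_iff]
    convert h using 2
    ext x
    simp
  obtain ⟨T₀, hT₀, hT₀m, hT₀e⟩ := hA.exists_measurable_subset_ae_eq
  rw [← measure_congr hT₀e] at hApos
  obtain ⟨T, hTm, hTs, hTpos, hTfin⟩ := Measure.exists_subset_measure_lt_top hT₀m hApos
  have hT0 : ∀ x ∈ T, ρ₀ x = 0 := fun x hx => (hT₀ (hTs hx)).1
  have hTU : ∀ x ∈ T, U x < E₀ := fun x hx => (hT₀ (hTs hx)).2
  have hτ : 0 < volume.real T := ENNReal.toReal_pos hTpos.ne' hTfin.ne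
  set c := M / volume.real T with hc
  have hcpos : 0 < c := by positivity
  set σ : R3 → ℝ := T.indicator (fun _ => c) with hσ
  have σin : ∀ x ∈ T, σ x = c := fun x hx => indicator_of_mem hx _
  have σout : ∀ x, x ∉ T → σ x = 0 := fun x hx => indicator_of_notMem hx _
  have σ0 : ∀ x, 0 ≤ σ x := fun x => indicator_nonneg (fun _ _ => hcpos.le) x
  have σi : Integrable σ := (integrable_indicator_iff hTm).mpr (integrableOn_const hTfin.ne)
  have σM : ∫ x, σ x = M := by
    rw [hσ, integral_indicator hTm, setIntegral_const, smul_eq_mul, hc]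
    field_simp
  have σm := σi.aestronglyMeasurable
  -- the Coulomb integrals are finite
  have psiT : Integrable (fun x => PsiOf Φ (ρ₀ x) + T.indicator (fun _ => PsiOf Φ c) x) :=
    hρ₀.psi_int.add ((integrable_indicator_iff hTm).mpr (integrableOn_const hTfin.ne))
  have hsum : CI (fun x => ρ₀ x + σ x) (fun x => ρ₀ x + σ x) := by
    refine coulomb_int' hG (fun x => add_nonneg (r0 x) (σ0 x)) (ri.add σi) ?_
    refine psiT.congr (Eventually.of_forall (fun x => ?_))
    by_cases hx : x ∈ T
    · simp [hT0 x hx, σin x hx, hx, psi_zero hG]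
    · simp [σout x hx, hx]
  have le1 : ∀ x, ρ₀ x ≤ ρ₀ x + σ x := fun x => by linarith [σ0 x]
  have le2 : ∀ x, σ x ≤ ρ₀ x + σ x := fun x => by linarith [r0 x]
  have c00 := CI_of_le hsum rm rm r0 r0 le1 le1
  have c01 := CI_of_le hsum rm σm r0 σ0 le1 le2
  have c10 := CI_of_le hsum σm rm σ0 r0 le2 le1
  have c11 := CI_of_le hsum σm σm σ0 σ0 le2 le2
  obtain ⟨u00, v00⟩ := BC_U0 c00
  obtain ⟨u10, v10⟩ := BC_U0 c10
  -- the Euler-Lagrange relation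
  have hLe : (fun x => E₀ * ρ₀ x + ρ₀ x * (-U x)) =ᵐ[volume] fun x => LG G (ρ₀ x) * ρ₀ x := by
    filter_upwards [hEL] with x hx
    rcases (r0 x).eq_or_lt with h | h
    · rw [← h]; simp
    · rw [hx h]; ring
  have hLi0 : Integrable (fun x => E₀ * ρ₀ x + ρ₀ x * (-U x)) := (ri.const_mul E₀).add u00
  have hLi : Integrable (fun x => LG G (ρ₀ x) * ρ₀ x) := hLi0.congr hLe
  have hLv : ∫ x, LG G (ρ₀ x) * ρ₀ x = E₀ * M + BC ρ₀ ρ₀ := by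
    rw [← integral_congr_ae hLe, integral_add (ri.const_mul E₀) u00, integral_const_mul,
      hρ₀.mass, v00]
  have hLtm : ∀ t : ℝ, t ∈ Ioo (0:ℝ) 1 →
      AEStronglyMeasurable (fun x => LG G ((1 - t) * ρ₀ x) * ρ₀ x) volume := by
    intro t ht
    have h1 : AEStronglyMeasurable (fun x => LG G (max ((1 - t) * ρ₀ x) 0)) volume :=
      (LG_cont hG).comp_aestronglyMeasurable (rm.const_mul (1 - t))
    have h2 : (fun x => LG G (max ((1 - t) * ρ₀ x) 0)) = fun x => LG G ((1 - t) * ρ₀ x) := by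
      funext x
      rw [max_eq_left (mul_nonneg (by linarith [ht.2]) (r0 x))]
    rw [h2] at h1
    exact h1.mul rm
  have hLtb : ∀ t : ℝ, t ∈ Ioo (0:ℝ) 1 → ∀ x,
      ‖LG G ((1 - t) * ρ₀ x) * ρ₀ x‖ ≤ LG G (ρ₀ x) * ρ₀ x := by
    intro t ht x
    have h1 : 0 ≤ (1 - t) * ρ₀ x := mul_nonneg (by linarith [ht.2]) (r0 x)
    have h2 : (1 - t) * ρ₀ x ≤ ρ₀ x := by nlinarith [r0 x, ht.1]
    rw [Real.norm_of_nonneg (mul_nonneg (LG_spec hG h1).1 (r0 x))]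
    exact mul_le_mul_of_nonneg_right (LG_mono hG _ _ h1 h2) (r0 x)
  -- the variational inequality
  have hvar : ∀ t : ℝ, t ∈ Ioo (0:ℝ) 1 →
      0 ≤ LG G (t * c) * M - (∫ x, LG G ((1 - t) * ρ₀ x) * ρ₀ x) + (1 - t/2) * BC ρ₀ ρ₀
        - (1 - t) * BC σ ρ₀ - t/2 * BC σ σ := by
    intro t ht
    have ht0 := ht.1
    have ht1 : 0 < 1 - t := by linarith [ht.2]
    set ρ : R3 → ℝ := fun x => (1 - t) * ρ₀ x + t * σ x with hρ
    have hρ0 : ∀ x, 0 ≤ ρ x := fun x =>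
      add_nonneg (mul_nonneg ht1.le (r0 x)) (mul_nonneg ht0.le (σ0 x))
    have hρi : Integrable ρ := (ri.const_mul _).add (σi.const_mul _)
    have hρin : ∀ x ∈ T, ρ x = t * c := fun x hx => by
      simp only [hρ, hT0 x hx, σin x hx]; ring
    have hρout : ∀ x, x ∉ T → ρ x = (1 - t) * ρ₀ x := fun x hx => by
      simp only [hρ, σout x hx]; ring
    have hmem : MemRM (PsiOf Φ) M ρ := by
      refine ⟨hρ0, hρi, ?_, ?_⟩
      · rw [hρ, integral_add (ri.const_mul _) (σi.const_mul _), integral_const_mul,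
          integral_const_mul, hρ₀.mass, σM]
        ring
      · refine psiT.mono' (psi_aesm hG hρ0 hρi.aestronglyMeasurable) ?_
        refine Eventually.of_forall (fun x => ?_)
        rw [Real.norm_of_nonneg (psi_nonneg hG (hρ0 x))]
        by_cases hx : x ∈ T
        · rw [hρin x hx, hT0 x hx, indicator_of_mem hx, psi_zero hG, zero_add]
          exact psi_mono hG (by positivity) (by nlinarith [ht.2])
        · rw [hρout x hx, indicator_of_notMem hx, add_zero]
          exact psi_mono hG (mul_nonneg ht1.le (r0 x)) (by nlinarith [r0 x])
    have hLt : Integrable (fun x => LG G ((1 - t) * ρ₀ x) * ρ₀ x) :=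
      hLi.mono' (hLtm t ht) (Eventually.of_forall (hLtb t ht))
    have hLd : Integrable (fun x => LG G (t * c) * σ x - LG G ((1 - t) * ρ₀ x) * ρ₀ x) :=
      (σi.const_mul _).sub hLt
    have hpsi : ∫ x, PsiOf Φ (ρ x) ≤ (∫ x, PsiOf Φ (ρ₀ x)) +
        t * (LG G (t * c) * M - ∫ x, LG G ((1 - t) * ρ₀ x) * ρ₀ x) := by
      have h1 : ∫ x, PsiOf Φ (ρ x) ≤ ∫ x, (PsiOf Φ (ρ₀ x) +
          t * (LG G (t * c) * σ x - LG G ((1 - t) * ρ₀ x) * ρ₀ x)) := by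
        apply integral_mono hmem.psi_int
        · exact hρ₀.psi_int.add (hLd.const_mul t)
        · intro x
          have h := psi_tangent hG (hρ0 x) (r0 x)
          beta_reduce
          by_cases hx : x ∈ T
          · rw [hρin x hx] at h ⊢
            rw [hT0 x hx] at h ⊢
            rw [σin x hx]
            linarith
          · rw [hρout x hx] at h ⊢
            rw [σout x hx]
            linarith
      rw [integral_add hρ₀.psi_int (hLd.const_mul t), integral_const_mul,
        integral_sub (σi.const_mul _) hLt, integral_const_mul, σM] at h1
      exact h1
    have hcρ : CI ρ ρ := coulomb_int' hG hρ0 hρi hmem.psi_int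
    have hH := hminr ρ hmem
    unfold Hr Epot at hH
    rw [Dpair_eq c00, Dpair_eq hcρ, hρ, BC_comb c00 c01 c10 c11] at hH
    rw [hρ] at hpsi
    have hfin : 0 ≤ t * (LG G (t * c) * M - (∫ x, LG G ((1 - t) * ρ₀ x) * ρ₀ x)
        + (1 - t/2) * BC ρ₀ ρ₀ - (1 - t) * BC σ ρ₀ - t/2 * BC σ σ) := by
      linarith
    exact nonneg_of_mul_nonneg_right hfin ht0
  -- pass to the limit
  have hIoo : ∀ᶠ t in 𝓝[>] (0:ℝ), t ∈ Ioo (0:ℝ) 1 := Ioo_mem_nhdsGT one_pos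
  have hid : Tendsto (fun t : ℝ => t) (𝓝[>] 0) (𝓝 0) := tendsto_nhdsWithin_of_tendsto_nhds tendsto_id
  have lim1 : Tendsto (fun t => LG G (t * c)) (𝓝[>] 0) (𝓝 0) := by
    have h1 : Tendsto (fun t : ℝ => LG G (max (t * c) 0)) (𝓝[>] 0) (𝓝 (LG G (max (0 * c) 0))) :=
      ((LG_cont hG).tendsto _).comp (hid.mul_const c)
    simp only [zero_mul, max_self, LG_zero hG] at h1
    refine h1.congr' ?_
    filter_upwards [hIoo] with t ht
    rw [max_eq_left (mul_nonneg ht.1.le hcpos.le)]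
  have lim2 : Tendsto (fun t => ∫ x, LG G ((1 - t) * ρ₀ x) * ρ₀ x) (𝓝[>] 0)
      (𝓝 (∫ x, LG G (ρ₀ x) * ρ₀ x)) := by
    apply tendsto_integral_filter_of_dominated_convergence (fun x => LG G (ρ₀ x) * ρ₀ x)
    · filter_upwards [hIoo] with t ht using hLtm t ht
    · filter_upwards [hIoo] with t ht using Eventually.of_forall (hLtb t ht)
    · exact hLi
    · refine Eventually.of_forall (fun x => ?_)
      have h0 : Tendsto (fun t : ℝ => (1 - t) * ρ₀ x) (𝓝[>] 0) (𝓝 ((1 - 0) * ρ₀ x)) :=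
        (hid.const_sub 1).mul_const _
      have h1 : Tendsto (fun t : ℝ => LG G (max ((1 - t) * ρ₀ x) 0)) (𝓝[>] 0)
          (𝓝 (LG G (max ((1 - 0) * ρ₀ x) 0))) := ((LG_cont hG).tendsto _).comp h0
      rw [sub_zero, one_mul, max_eq_left (r0 x)] at h1
      refine Tendsto.mul_const _ (h1.congr' ?_)
      filter_upwards [hIoo] with t ht
      rw [max_eq_left (mul_nonneg (by linarith [ht.2]) (r0 x))]
  have lim : Tendsto (fun t => LG G (t * c) * M - (∫ x, LG G ((1 - t) * ρ₀ x) * ρ₀ x)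
      + (1 - t/2) * BC ρ₀ ρ₀ - (1 - t) * BC σ ρ₀ - t/2 * BC σ σ) (𝓝[>] 0)
      (𝓝 (0 * M - (∫ x, LG G (ρ₀ x) * ρ₀ x) + (1 - 0/2) * BC ρ₀ ρ₀ - (1 - 0) * BC σ ρ₀
        - 0/2 * BC σ σ)) :=
    ((((lim1.mul_const M).sub lim2).add (((hid.div_const 2).const_sub 1).mul_const _)).sub
      ((hid.const_sub 1).mul_const _)).sub ((hid.div_const 2).mul_const _)
  have hge := ge_of_tendsto lim (hIoo.mono hvar)
  rw [hLv] at hge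
  have hle : E₀ * M + BC σ ρ₀ ≤ 0 := by linarith
  -- contradiction
  have hint : Integrable (fun x => E₀ * σ x + σ x * (-U x)) := (σi.const_mul E₀).add u10
  have hval : ∫ x, (E₀ * σ x + σ x * (-U x)) = E₀ * M + BC σ ρ₀ := by
    rw [integral_add (σi.const_mul E₀) u10, integral_const_mul, σM, v10]
  have hnn : ∀ x, 0 ≤ E₀ * σ x + σ x * (-U x) := by
    intro x
    by_cases hx : x ∈ T
    · have := mul_nonneg (σ0 x) (sub_nonneg.mpr (hTU x hx).le)
      linarith
    · simp [σout x hx]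
  have hzero : ∫ x, (E₀ * σ x + σ x * (-U x)) = 0 :=
    le_antisymm (by rw [hval]; exact hle) (integral_nonneg hnn)
  rw [integral_eq_zero_iff_of_nonneg hnn hint] at hzero
  have : volume T = 0 := by
    refine measure_mono_null ?_ (ae_iff.mp hzero)
    intro x hx
    have h1 := mul_pos hcpos (sub_pos.mpr (hTU x hx))
    simp only [mem_ofPred_eq, Pi.zero_apply, σin x hx]
    intro h2
    linarith
  exact hTpos.ne' this

lemma f0Of_eq {Φ Φinv : ℝ → ℝ} (hG : GoodG Φ (fun y => Φinv (max y 0))) (ρ₀ : R3 → ℝ) (E₀ : ℝ)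
    (p : R3 × R3) : f0Of Φinv ρ₀ E₀ p =
      (fun y => Φinv (max y 0)) ((E₀ - U0rho ρ₀ p.1) - (1/2) * ‖p.2‖ ^ 2) := by
  unfold f0Of
  split_ifs with h
  · simp only
    rw [max_eq_left (by linarith)]
    congr 1
    ring
  · exact (hG.zero _ (by linarith)).symm

/-- A phase-space density lies above its reduction. -/
lemma reduce_mem {Φ G : ℝ → ℝ} (hG : GoodG Φ G) {M : ℝ} {g : R3 × R3 → ℝ} (hg : MemFM Φ M g) :
    MemRM (PsiOf Φ) M (spatialDensity g) ∧ Hr (PsiOf Φ) (spatialDensity g) ≤ HC Φ g := by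
  have gi : Integrable g ((volume : Measure R3).prod volume) := hg.integrable
  have hh : Integrable (fun p : R3 × R3 => (1/2) * ‖p.2‖ ^ 2 * g p + Φ (g p))
      ((volume : Measure R3).prod volume) := by
    refine ((hg.kin_int.const_mul (1/2)).add hg.cas_int).congr (Eventually.of_forall (fun p => ?_))
    simp only [Pi.add_apply]; ring
  have hle : ∀ᵐ x : R3, PsiOf Φ (spatialDensity g x) ≤
      ∫ v, ((1/2) * ‖v‖ ^ 2 * g (x, v) + Φ (g (x, v))) := by
    filter_upwards [gi.prod_right_ae, hh.prod_right_ae] with x h1 h2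
    exact psi_le hG.phi_nonneg (fun v => hg.nonneg _) h1 h2
  have d0 : ∀ x, 0 ≤ spatialDensity g x := fun x => integral_nonneg (fun v => hg.nonneg _)
  have di : Integrable (spatialDensity g) := gi.integral_prod_left
  have hi := hh.integral_prod_left
  have hpi : Integrable (fun x => PsiOf Φ (spatialDensity g x)) := by
    refine hi.mono' (psi_aesm hG d0 di.aestronglyMeasurable) ?_
    filter_upwards [hle] with x hx
    rw [Real.norm_of_nonneg (psi_nonneg hG (d0 x))]
    exact hx
  refine ⟨⟨d0, di, ?_, hpi⟩, ?_⟩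
  · rw [← hg.mass]
    exact (integral_prod _ gi).symm
  · have h1 : ∫ x, PsiOf Φ (spatialDensity g x) ≤
        ∫ p : R3 × R3, ((1/2) * ‖p.2‖ ^ 2 * g p + Φ (g p)) ∂((volume : Measure R3).prod volume) := by
      rw [integral_prod _ hh]
      exact integral_mono_ae hpi hi hle
    have h2 : ∫ p : R3 × R3, ((1/2) * ‖p.2‖ ^ 2 * g p + Φ (g p))
        ∂((volume : Measure R3).prod volume) = Ekin g + Casimir Φ g := by
      unfold Ekin Casimir
      rw [← integral_const_mul, ← integral_add (hg.kin_int.const_mul (1/2)) hg.cas_int]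
      congr 1
      funext p
      ring
    unfold Hr HC
    linarith

lemma lift_main {Φ G : ℝ → ℝ} (hG : GoodG Φ G) {M : ℝ}
    {ρ₀ : R3 → ℝ} (hρ₀ : MemRM (PsiOf Φ) M ρ₀) {W : R3 → ℝ} (hW : Measurable W)
    (hmW : ∀ᵐ x : R3, mG G (W x) = ρ₀ x) {f : R3 × R3 → ℝ}
    (hf : ∀ p, f p = G (W p.1 - (1/2) * ‖p.2‖ ^ 2)) :
    MemFM Φ M f ∧ HC Φ f = Hr (PsiOf Φ) ρ₀ := by
  have hf' : f = fun p : R3 × R3 => G (W p.1 - (1/2) * ‖p.2‖ ^ 2) := funext hf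
  have am : Measurable (fun p : R3 × R3 => W p.1 - (1/2) * ‖p.2‖ ^ 2) := by fun_prop
  have fm : Measurable f := by rw [hf']; exact hG.cont.measurable.comp am
  have f0 : ∀ p, 0 ≤ f p := fun p => by rw [hf]; exact hG.nonneg _
  have pm : Measurable (fun p => Φ (f p)) := by
    rw [hf']; exact (phi_prof_cont hG).measurable.comp am
  have p0 : ∀ p, 0 ≤ Φ (f p) := fun p => hG.phi_nonneg _ (f0 p)
  have k0 : ∀ p : R3 × R3, 0 ≤ (1/2) * ‖p.2‖ ^ 2 * f p := fun p => by
    have := f0 p; positivity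
  have hmm : Measurable (fun p : R3 × R3 => (1/2) * ‖p.2‖ ^ 2 * f p + Φ (f p)) :=
    Measurable.add (by fun_prop) pm
  have hsd : ∀ᵐ x : R3, spatialDensity f x = ρ₀ x := by
    filter_upwards [hmW] with x hx
    rw [← hx]
    unfold spatialDensity mG
    simp only [hf]
  have hsp : ∀ᵐ x : R3, ∫ v, ((1/2) * ‖v‖ ^ 2 * f (x, v) + Φ (f (x, v))) = PsiOf Φ (ρ₀ x) := by
    filter_upwards [hmW] with x hx
    rw [← hx, prof_attain hG]
    simp only [hf]
  have fi : Integrable f ((volume : Measure R3).prod volume) := by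
    rw [integrable_prod_iff fm.aestronglyMeasurable]
    constructor
    · refine Eventually.of_forall (fun x => ?_)
      simp only [hf]
      exact prof_int hG _
    · simp only [Real.norm_of_nonneg (f0 _)]
      refine hρ₀.integrable.congr ?_
      filter_upwards [hsd] with x hx using hx.symm
  have hi : Integrable (fun p : R3 × R3 => (1/2) * ‖p.2‖ ^ 2 * f p + Φ (f p))
      ((volume : Measure R3).prod volume) := by
    rw [integrable_prod_iff hmm.aestronglyMeasurable]
    constructor
    · refine Eventually.of_forall (fun x => ?_)
      simp only [hf]
      exact prof_h_int hG _
    · refine hρ₀.psi_int.congr ?_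
      filter_upwards [hsp] with x hx
      rw [← hx]
      congr 1
      funext v
      rw [Real.norm_of_nonneg (add_nonneg (k0 (x, v)) (p0 (x, v)))]
  have ki : Integrable (fun p : R3 × R3 => ‖p.2‖ ^ 2 * f p) ((volume : Measure R3).prod volume) := by
    refine (hi.const_mul 2).mono' ?_ ?_
    · exact Measurable.aestronglyMeasurable (by fun_prop)
    · refine Eventually.of_forall (fun p => ?_)
      have h1 := k0 p
      have h2 := p0 p
      rw [Real.norm_of_nonneg (by linarith)]
      linarith
  have ci : Integrable (fun p : R3 × R3 => Φ (f p)) ((volume : Measure R3).prod volume) := by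
    refine hi.mono' pm.aestronglyMeasurable ?_
    refine Eventually.of_forall (fun p => ?_)
    have h1 := k0 p
    have h2 := p0 p
    rw [Real.norm_of_nonneg h2]
    linarith
  refine ⟨⟨f0, fi, ?_, ki, ci⟩, ?_⟩
  · rw [← hρ₀.mass]
    refine (integral_prod _ fi).trans ?_
    exact integral_congr_ae hsd
  · have h1 : ∫ p : R3 × R3, ((1/2) * ‖p.2‖ ^ 2 * f p + Φ (f p))
        ∂((volume : Measure R3).prod volume) = Ekin f + Casimir Φ f := by
      unfold Ekin Casimir
      rw [← integral_const_mul]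
      refine Eq.trans ?_ (integral_add (ki.const_mul (1/2)) ci)
      congr 1
      funext p
      ring
    rw [integral_prod _ hi, integral_congr_ae hsp] at h1
    have h2 : Epot (spatialDensity f) = Epot ρ₀ := by
      unfold Epot Dpair
      congr 1
      apply integral_congr_ae
      filter_upwards [hsd] with x hx
      apply integral_congr_ae
      filter_upwards [hsd] with y hy
      rw [hx, hy]
    unfold HC Hr
    rw [h2]
    linarith

/-- lifting a minimizer `ρ₀` of the reduced functional `H_r` to a
minimizer `f₀` of the energy-Casimir functional `H_C`. -/
theorem lift_reduced_minimizer
    (Φ Φ' : ℝ → ℝ) (k k' : ℝ) (hΦ : IsPhi Φ Φ' k k') (M : ℝ) (hM : 0 < M)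
    (Φinv : ℝ → ℝ)
    (hmap : ∀ s, 0 ≤ s → 0 ≤ Φ' s)
    (hleft : ∀ s, 0 ≤ s → Φinv (Φ' s) = s)
    (hright : ∀ y, 0 ≤ y → 0 ≤ Φinv y ∧ Φ' (Φinv y) = y)
    (ρ₀ : R3 → ℝ) (hρ₀ : MemRM (PsiOf Φ) M ρ₀)
    (hminr : ∀ ρ, MemRM (PsiOf Φ) M ρ → Hr (PsiOf Φ) ρ₀ ≤ Hr (PsiOf Φ) ρ)
    (E₀ : ℝ)
    (hEL : ∀ᵐ x ∂(volume : Measure R3),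
      (0 < ρ₀ x → deriv (PsiOf Φ) (ρ₀ x) = E₀ - U0rho ρ₀ x) ∧
      (E₀ ≤ U0rho ρ₀ x → ρ₀ x = 0)) :
    MemFM Φ M (f0Of Φinv ρ₀ E₀) ∧
    ∀ g, MemFM Φ M g → HC Φ (f0Of Φinv ρ₀ E₀) ≤ HC Φ g := by
  have hG := goodG_of hΦ hmap hleft hright
  set G : ℝ → ℝ := fun y => Φinv (max y 0) with hGdef
  have hEL' : ∀ᵐ x ∂(volume : Measure R3), 0 < ρ₀ x → LG G (ρ₀ x) = E₀ - U0rho ρ₀ x := by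
    filter_upwards [hEL] with x hx h
    rw [← psi_deriv hG h]
    exact hx.1 h
  have hvac := vacuum hG hM hρ₀ hminr hEL'
  have hmW : ∀ᵐ x : R3, mG G (E₀ - U0rho ρ₀ x) = ρ₀ x := by
    filter_upwards [hEL', hvac] with x h1 h2
    rcases (hρ₀.nonneg x).eq_or_lt with h | h
    · rw [← h]
      exact mG_zero hG (by linarith [h2 h.symm])
    · rw [← h1 h]
      exact (LG_spec hG h.le).2
  obtain ⟨hmem, hval⟩ := lift_main hG hρ₀
    (W := fun x => E₀ - U0rho ρ₀ x)
    (measurable_const.sub (U0_meas hρ₀.integrable.aestronglyMeasurable)) hmW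
    (f0Of_eq hG ρ₀ E₀)
  refine ⟨hmem, fun g hg => ?_⟩
  obtain ⟨h1, h2⟩ := reduce_mem hG hg
  rw [hval]
  exact (hminr _ h1).trans h2
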